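/- For every integer $n \geq 0$, $N^+(1, 21, 42n + 43) + N^+(19, 21, 42n + 50) = N^+(3, 21, 42n + 45) + N^+(4, 21, 42n + 27)$. -/

import Mathlib

/-- The Dyson rank of a partition: its largest part minus its number of parts. -/
def Nat.Partition.rank {n : ℕ} (l : n.Partition) : ℤ :=
  (l.parts.sup : ℤ) - l.parts.card

/-- `N⁺ r m n`: the number of partitions of `n` whose rank is congruent to `r` modulo `m`
and has absolute value at least `n / 2` (`0` when `n` is not a positive integer). -/
noncomputable def rankCountPlus (r m n : ℤ) : ℕ :=
  if 0 < n then
    Nat.card {l : Nat.Partition n.toNat //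
      l.rank ≡ r [ZMOD m] ∧ (n : ℚ) / 2 ≤ |(l.rank : ℚ)|}
  else 0

namespace YoungDiagram

theorem sum_rowLens (μ : YoungDiagram) : μ.rowLens.sum = μ.card := by
  have h : ∀ c ∈ μ.cells, c.1 ∈ Finset.range (μ.colLen 0) := fun c hc => by
    rw [Finset.mem_range, ← mem_iff_lt_colLen]
    exact μ.up_left_mem le_rfl (Nat.zero_le c.2) hc
  rw [YoungDiagram.card, Finset.card_eq_sum_card_fiberwise h, rowLens,
    ← List.sum_toFinset _ List.nodup_range, List.toFinset_range]
  exact Finset.sum_congr rfl fun i _ => rowLen_eq_card μ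

theorem card_transpose (μ : YoungDiagram) : μ.transpose.card = μ.card := by
  simp [YoungDiagram.card, transpose]

theorem sup_rowLens (μ : YoungDiagram) :
    (μ.rowLens : Multiset ℕ).sup = μ.rowLen 0 := by
  refine le_antisymm (Multiset.sup_le.2 fun b hb => ?_) ?_
  · obtain ⟨i, -, rfl⟩ := List.mem_map.1 (Multiset.mem_coe.1 hb)
    exact μ.rowLen_anti 0 i (Nat.zero_le i)
  · rcases Nat.eq_zero_or_pos (μ.rowLen 0) with h | h
    · simp [h]
    · refine Multiset.le_sup (Multiset.mem_coe.2 (List.mem_map.2 ⟨0, ?_, rfl⟩))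
      rwa [List.mem_range, ← mem_iff_lt_colLen, mem_iff_lt_rowLen]

end YoungDiagram

namespace Nat.Partition

/-- The Young diagram whose row lengths are the parts of a partition. -/
def youngDiagram {n : ℕ} (l : n.Partition) : YoungDiagram :=
  YoungDiagram.ofRowLens (l.parts.sort (· ≥ ·)) (Multiset.pairwise_sort _ _).sortedGE

theorem coe_rowLens_youngDiagram {n : ℕ} (l : n.Partition) :
    (l.youngDiagram.rowLens : Multiset ℕ) = l.parts := by
  rw [youngDiagram, YoungDiagram.rowLens_ofRowLens_eq_self, Multiset.sort_eq]
  exact fun x hx => l.parts_pos ((Multiset.mem_sort _).1 hx)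

theorem card_youngDiagram {n : ℕ} (l : n.Partition) : l.youngDiagram.card = n := by
  rw [← YoungDiagram.sum_rowLens, ← Multiset.sum_coe, coe_rowLens_youngDiagram, l.parts_sum]

theorem rank_eq_rowLen_sub_colLen {n : ℕ} (l : n.Partition) :
    l.rank = (l.youngDiagram.rowLen 0 : ℤ) - l.youngDiagram.colLen 0 := by
  rw [rank, ← coe_rowLens_youngDiagram, YoungDiagram.sup_rowLens, Multiset.coe_card,
    YoungDiagram.length_rowLens]

/-- The conjugate partition. -/
def conjugate {n : ℕ} (l : n.Partition) : n.Partition where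
  parts := l.youngDiagram.transpose.rowLens
  parts_pos hi := YoungDiagram.pos_of_mem_rowLens _ _ (Multiset.mem_coe.1 hi)
  parts_sum := by
    rw [Multiset.sum_coe, YoungDiagram.sum_rowLens, YoungDiagram.card_transpose,
      card_youngDiagram]

theorem youngDiagram_conjugate {n : ℕ} (l : n.Partition) :
    l.conjugate.youngDiagram = l.youngDiagram.transpose := by
  apply YoungDiagram.equivListRowLens.injective
  apply Subtype.ext
  exact List.Perm.eq_of_sortedGE (YoungDiagram.rowLens_sorted _) (YoungDiagram.rowLens_sorted _)
    (Multiset.coe_eq_coe.1 l.conjugate.coe_rowLens_youngDiagram)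

theorem conjugate_involutive {n : ℕ} : Function.Involutive (conjugate (n := n)) := fun l => by
  ext1
  rw [← coe_rowLens_youngDiagram, youngDiagram_conjugate, youngDiagram_conjugate,
    YoungDiagram.transpose_transpose, coe_rowLens_youngDiagram]

theorem rank_conjugate {n : ℕ} (l : n.Partition) : l.conjugate.rank = -l.rank := by
  simp [rank_eq_rowLen_sub_colLen, youngDiagram_conjugate]

theorem rank_lt {n : ℕ} (l : n.Partition) (hn : 0 < n) : l.rank < n := by
  have h : l.parts.sup ≤ n := Multiset.sup_le.2 fun b hb => l.le_of_mem_parts hb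
  have h' : 0 < l.parts.card := Multiset.card_pos.2 fun h0 => by
    have := l.parts_sum
    simp [h0] at this
    omega
  rw [rank]
  omega

theorem sup_mem_parts {n : ℕ} (l : n.Partition) (hn : 0 < n) : l.parts.sup ∈ l.parts := by
  have h0 : l.youngDiagram.card ≠ 0 := by rw [card_youngDiagram]; omega
  rw [← coe_rowLens_youngDiagram, YoungDiagram.sup_rowLens]
  refine Multiset.mem_coe.2 (List.mem_map.2 ⟨0, ?_, rfl⟩)
  obtain ⟨c, hc⟩ := Finset.card_ne_zero.1 h0
  rw [List.mem_range, ← YoungDiagram.mem_iff_lt_colLen]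
  exact l.youngDiagram.up_left_mem (Nat.zero_le _) (Nat.zero_le _) hc

/-- Prepending a part that makes the rank equal to `k`, after decreasing every part by one. -/
def prependOfRank {s : ℕ} (k : ℕ) (p : {p : s.Partition // 1 ∉ p.parts}) :
    (s + 1 + k).Partition where
  parts := (k + p.1.parts.card + 1) ::ₘ p.1.parts.map (· - 1)
  parts_pos {i} hi := by
    rcases Multiset.mem_cons.1 hi with rfl | hi
    · omega
    · obtain ⟨j, hj, rfl⟩ := Multiset.mem_map.1 hi
      have h₀ := p.1.parts_pos hj
      have h₁ : j ≠ 1 := fun h => p.2 (h ▸ hj)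
      omega
  parts_sum := by
    have h : (p.1.parts.map (· - 1)).sum + p.1.parts.card = s := by
      conv_rhs => rw [← p.1.parts_sum, ← Multiset.map_id' p.1.parts]
      rw [← mul_one p.1.parts.card, ← smul_eq_mul, ← Multiset.sum_replicate,
        ← Multiset.map_const', ← Multiset.sum_map_add]
      exact congrArg _ (Multiset.map_congr rfl fun j hj => Nat.sub_add_cancel (p.1.parts_pos hj))
    rw [Multiset.sum_cons]
    omega

theorem sup_prependOfRank {s k : ℕ} (hk : s < k) (p : {p : s.Partition // 1 ∉ p.parts}) :
    (prependOfRank k p).parts.sup = k + p.1.parts.card + 1 := by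
  have h : (p.1.parts.map (· - 1)).sup ≤ k + p.1.parts.card + 1 := Multiset.sup_le.2 fun b hb => by
    obtain ⟨j, hj, rfl⟩ := Multiset.mem_map.1 hb
    have := p.1.le_of_mem_parts hj
    omega
  rw [prependOfRank, Multiset.sup_cons]
  exact sup_eq_left.2 h

theorem rank_prependOfRank {s k : ℕ} (hk : s < k) (p : {p : s.Partition // 1 ∉ p.parts}) :
    (prependOfRank k p).rank = k := by
  rw [rank, sup_prependOfRank hk, prependOfRank, Multiset.card_cons, Multiset.card_map]
  push_cast
  ring

/-- Deleting the largest part and increasing every other part by one identifies the partitions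
of `s + 1 + k` of rank `k > s` with the partitions of `s` into parts greater than one. -/
def rankEquiv {s k : ℕ} (hk : s < k) :
    {l : (s + 1 + k).Partition // l.rank = k} ≃ {p : s.Partition // 1 ∉ p.parts} where
  toFun l := ⟨{
      parts := (l.1.parts.erase l.1.parts.sup).map (· + 1)
      parts_pos := fun hi => by
        obtain ⟨j, -, rfl⟩ := Multiset.mem_map.1 hi
        exact j.succ_pos
      parts_sum := by
        have hm := l.1.sup_mem_parts (by omega)
        have h₁ := Multiset.sum_erase hm
        have h₂ := Multiset.card_erase_add_one hm
        have h₃ := l.2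
        rw [rank] at h₃
        rw [l.1.parts_sum] at h₁
        rw [Multiset.sum_map_add, Multiset.map_id', Multiset.map_const', Multiset.sum_replicate,
          smul_eq_mul]
        omega }, fun h => by
    obtain ⟨j, hj, hj'⟩ := Multiset.mem_map.1 h
    have := l.1.parts_pos (Multiset.mem_of_mem_erase hj)
    omega⟩
  invFun p := ⟨prependOfRank k p, rank_prependOfRank hk p⟩
  left_inv l := by
    have hm := l.1.sup_mem_parts (by omega)
    have h₂ := Multiset.card_erase_add_one hm
    have h₃ := l.2
    rw [rank] at h₃
    ext1
    ext1
    simp only [prependOfRank, Multiset.card_map, Multiset.map_map, Function.comp_def,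
      Nat.add_sub_cancel, Multiset.map_id']
    conv_rhs => rw [← Multiset.cons_erase hm]
    congr 1
    omega
  right_inv p := by
    ext1
    ext1
    simp only [sup_prependOfRank hk]
    simp only [prependOfRank, Multiset.erase_cons_head, Multiset.map_map, Function.comp_def]
    conv_rhs => rw [← Multiset.map_id' p.1.parts]
    exact Multiset.map_congr rfl fun j hj => Nat.sub_add_cancel (p.1.parts_pos hj)

theorem card_rank_modEq {n : ℕ} (hn : 0 < n) (r m : ℤ) :
    Nat.card {l : n.Partition // l.rank ≡ r [ZMOD m] ∧ (n : ℤ) ≤ 2 * l.rank} =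
      ∑ s ∈ Finset.range (n / 2) with ((s : ℕ) : ℤ) ≡ n - 1 - r [ZMOD m],
        Nat.card {p : s.Partition // 1 ∉ p.parts} := by
  classical
  have h : ∀ l ∈ ({l | l.rank ≡ r [ZMOD m] ∧ (n : ℤ) ≤ 2 * l.rank} : Finset n.Partition),
      (n - 1 - l.rank).toNat ∈
        ({s ∈ Finset.range (n / 2) | ((s : ℕ) : ℤ) ≡ n - 1 - r [ZMOD m]} : Finset ℕ) := by
    intro l hl
    obtain ⟨h₁, h₂⟩ := (Finset.mem_filter.1 hl).2
    have h₃ := l.rank_lt hn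
    rw [Finset.mem_filter, Finset.mem_range, Int.toNat_of_nonneg (by omega)]
    exact ⟨by omega, h₁.sub_left _⟩
  rw [Nat.card_eq_fintype_card, Fintype.card_subtype, Finset.card_eq_sum_card_fiberwise h]
  refine Finset.sum_congr rfl fun s hs => ?_
  obtain ⟨hs₁, hs₂⟩ := Finset.mem_filter.1 hs
  rw [Finset.mem_range] at hs₁
  obtain ⟨k, rfl⟩ : ∃ k, n = s + 1 + k := ⟨n - (s + 1), by omega⟩
  have hk : s < k := by omega
  have hs₃ : (k : ℤ) ≡ r [ZMOD m] := by
    have := hs₂.sub_left (s + k : ℤ)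
    push_cast at this
    ring_nf at this
    exact this
  rw [← Nat.card_congr (rankEquiv hk), Nat.card_eq_fintype_card, Fintype.card_subtype,
    Finset.filter_filter]
  congr 1
  refine Finset.filter_congr fun l _ => ⟨fun ⟨⟨_, h₂⟩, h₄⟩ => ?_, fun hl => ?_⟩
  · have := l.rank_lt hn
    omega
  · rw [hl]
    exact ⟨⟨hs₃, by omega⟩, by omega⟩

end Nat.Partition

open Nat.Partition in
theorem rankCountPlus_eq_sum {n : ℕ} (hn : 0 < n) (r m : ℤ) :
    rankCountPlus r m n =
      ∑ s ∈ Finset.range (n / 2) with ((s : ℕ) : ℤ) ≡ n - 1 - r [ZMOD m],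
          Nat.card {p : s.Partition // 1 ∉ p.parts} +
        ∑ s ∈ Finset.range (n / 2) with ((s : ℕ) : ℤ) ≡ n - 1 + r [ZMOD m],
          Nat.card {p : s.Partition // 1 ∉ p.parts} := by
  classical
  have hneg := card_rank_modEq hn (-r) m
  rw [sub_neg_eq_add] at hneg
  rw [← card_rank_modEq hn r m, ← hneg, rankCountPlus, if_pos (by exact_mod_cast hn)]
  have hconj : Nat.card {l : n.Partition // l.rank ≡ -r [ZMOD m] ∧ (n : ℤ) ≤ 2 * l.rank} =
      Nat.card {l : n.Partition // l.rank ≡ r [ZMOD m] ∧ (n : ℤ) ≤ 2 * -l.rank} :=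
    Nat.card_congr <| conjugate_involutive.toPerm.subtypeEquiv fun l => by
      simp only [Function.Involutive.coe_toPerm, rank_conjugate, neg_neg]
      rw [← Int.neg_modEq_neg, neg_neg]
  have habs (l : n.Partition) :
      ((n : ℤ) : ℚ) / 2 ≤ |(l.rank : ℚ)| ↔ (n : ℤ) ≤ 2 * l.rank ∨ (n : ℤ) ≤ 2 * -l.rank := by
    rw [div_le_iff₀ two_pos, ← Int.cast_abs]
    norm_cast
    rcases abs_cases l.rank with h | h <;> omega
  rw [hconj, Int.toNat_natCast]
  simp only [habs, Nat.card_eq_fintype_card, Fintype.card_subtype]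
  rw [← Finset.card_union_of_disjoint, ← Finset.filter_or]
  · simp only [and_or_left]
  · exact Finset.disjoint_filter.2 fun l _ h₁ h₂ => by omega

theorem rankCountPlus_ex21 (n : ℤ) (hn : 0 ≤ n) :
    rankCountPlus 1 21 (42 * n + 43) + rankCountPlus 19 21 (42 * n + 50)
      = rankCountPlus 3 21 (42 * n + 45) + rankCountPlus 4 21 (42 * n + 27) := by
  lift n to ℕ using hn
  have key (c N : ℕ) (x : ℤ) (hx : x % 21 = c) (h₁ : 21 * n + c < N) (h₂ : N ≤ 21 * n + 21 + c) :
      ({s ∈ Finset.range N | ((s : ℕ) : ℤ) ≡ x [ZMOD 21]} : Finset ℕ) =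
        {s ∈ Finset.range (21 * n + 21) | s % 21 = c} := by
    ext s
    simp only [Finset.mem_filter, Finset.mem_range, Int.ModEq, hx] at hx ⊢
    norm_cast
    refine ⟨fun ⟨_, _⟩ => ⟨?_, ?_⟩, fun ⟨_, _⟩ => ⟨?_, ?_⟩⟩ <;> omega
  have count (b c d : ℕ) (r : ℤ) (hc : (b - 1 - r) % 21 = c) (hd : (b - 1 + r) % 21 = d)
      (hb : 0 < b) (hcb : c < b / 2) (hdb : d < b / 2) (hbc : b / 2 ≤ 21 + c)
      (hbd : b / 2 ≤ 21 + d) := by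
    have h := rankCountPlus_eq_sum (n := 42 * n + b) (by omega) r 21
    rw [key c _ _ (by push_cast; omega) (by omega) (by omega),
      key d _ _ (by push_cast; omega) (by omega) (by omega)] at h
    exact h
  have h₁ := count 43 20 1 1 (by norm_num) (by norm_num) (by norm_num) (by norm_num)
    (by norm_num) (by norm_num) (by norm_num)
  have h₂ := count 50 9 5 19 (by norm_num) (by norm_num) (by norm_num) (by norm_num)
    (by norm_num) (by norm_num) (by norm_num)
  have h₃ := count 45 20 5 3 (by norm_num) (by norm_num) (by norm_num) (by norm_num)
    (by norm_num) (by norm_num) (by norm_num)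
  have h₄ := count 27 1 9 4 (by norm_num) (by norm_num) (by norm_num) (by norm_num)
    (by norm_num) (by norm_num) (by norm_num)
  push_cast at h₁ h₂ h₃ h₄
  rw [h₁, h₂, h₃, h₄]
  omega
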